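/- Let ℓ > 0, 1 < p < ∞, and let γ : ℝ → ℝ be continuous, strictly increasing and surjective with γ(0) = 0. For every f ∈ L^1(0,ℓ) and every a, b ∈ ℝ there exists a weak solution v of the Neumann problem (P^{γ,f}_{p,a,b}), and it is unique: any two weak solutions coincide a.e. on (0,ℓ). -/

import Mathlib

open MeasureTheory Set Filter

noncomputable section

/-- A connected compact metric graph: finite nonempty vertex set, finite edge set,
initial/terminal vertex maps without loops, positive edge lengths, no multiple edges,
and connectedness via paths of edges. -/
structure MetricGraph where
  V : Type
  E : Type
  fintypeV : Fintype V
  fintypeE : Fintype E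
  nonemptyV : Nonempty V
  ι : E → V
  τ : E → V
  no_loops : ∀ e, ι e ≠ τ e
  len : E → ℝ
  len_pos : ∀ e, 0 < len e
  no_multi : ∀ e e', ({ι e, τ e} : Set V) = ({ι e', τ e'} : Set V) → e = e'
  connected : ∀ v w : V,
    Relation.ReflTransGen (fun a b => ∃ e, (ι e = a ∧ τ e = b) ∨ (ι e = b ∧ τ e = a)) v w

/-- Sum over the edges of the graph. -/
def edgeSum (G : MetricGraph) (F : G.E → ℝ) : ℝ :=
  letI := G.fintypeE
  ∑ e, F e

/-- Sum over the vertices of the graph. -/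
def vertexSum (G : MetricGraph) (F : G.V → ℝ) : ℝ :=
  letI := G.fintypeV
  ∑ v, F v

/-- Number of vertices. -/
def vertexCard (G : MetricGraph) : ℕ :=
  letI := G.fintypeV
  Fintype.card G.V

/-- ρ_p(r) = |r|^(p-2) r. -/
def rho (p r : ℝ) : ℝ := |r| ^ (p - 2) * r

/-- `(u, u')` is in the Sobolev space W^{1,p}(0,ℓ): `u'` is integrable with `|u'|^p`
integrable on (0,ℓ), and `u` is absolutely continuous on [0,ℓ] with derivative `u'`. -/
def IntervalSobolev (ℓ p : ℝ) (u u' : ℝ → ℝ) : Prop :=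
  IntegrableOn u' (Ioo 0 ℓ) volume ∧
  IntegrableOn (fun x => |u' x| ^ p) (Ioo 0 ℓ) volume ∧
  ∀ x ∈ Icc (0:ℝ) ℓ, u x = u 0 + ∫ t in (0:ℝ)..x, u' t

/-- `(u, u')` is in W^{1,p̄}(G), continuous at the vertices with vertex values `uV`. -/
def GraphSobolev (G : MetricGraph) (p : G.E → ℝ) (u u' : G.E → ℝ → ℝ) (uV : G.V → ℝ) : Prop :=
  (∀ e, IntervalSobolev (G.len e) (p e) (u e) (u' e)) ∧
  (∀ e, u e 0 = uV (G.ι e)) ∧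
  (∀ e, u e (G.len e) = uV (G.τ e))

/-- `v` is a weak solution of the graph problem (P_ω^f) with data `u, u', uV`. -/
def SolvesGraphProblem (G : MetricGraph) (p : G.E → ℝ) (γ : G.E → ℝ → ℝ)
    (f : G.E → ℝ → ℝ) (ω : G.V → ℝ)
    (v : G.E → ℝ → ℝ) (u u' : G.E → ℝ → ℝ) (uV : G.V → ℝ) : Prop :=
  (∀ e, IntegrableOn (v e) (Ioo 0 (G.len e)) volume) ∧
  GraphSobolev G p u u' uV ∧
  (∀ e, ∀ᵐ x ∂(volume.restrict (Ioo 0 (G.len e))), v e x = γ e (u e x)) ∧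
  ∀ φ φ' : G.E → ℝ → ℝ, ∀ φV : G.V → ℝ, GraphSobolev G p φ φ' φV →
    edgeSum G (fun e => ∫ x in Ioo 0 (G.len e), v e x * φ e x)
      + edgeSum G (fun e => ∫ x in Ioo 0 (G.len e), rho (p e) (u' e x) * φ' e x)
    = edgeSum G (fun e => ∫ x in Ioo 0 (G.len e), f e x * φ e x)
      + vertexSum G (fun w => ω w * φV w)

/-- `v` is a weak solution of the graph problem (P_ω^f). -/
def IsGraphWeakSolution (G : MetricGraph) (p : G.E → ℝ) (γ : G.E → ℝ → ℝ)
    (f : G.E → ℝ → ℝ) (ω : G.V → ℝ) (v : G.E → ℝ → ℝ) : Prop :=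
  ∃ u u' uV, SolvesGraphProblem G p γ f ω v u u' uV

/-- `v` is a weak solution of the interval Neumann problem (P^{γ,f}_{p,a,b}),
with associated Sobolev function `u` (derivative `u'`). -/
def SolvesNeumann (ℓ p : ℝ) (γ f : ℝ → ℝ) (a b : ℝ) (v u u' : ℝ → ℝ) : Prop :=
  IntegrableOn v (Ioo 0 ℓ) volume ∧
  IntervalSobolev ℓ p u u' ∧
  (∀ᵐ x ∂(volume.restrict (Ioo 0 ℓ)), v x = γ (u x)) ∧
  ∀ φ φ' : ℝ → ℝ, IntervalSobolev ℓ p φ φ' →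
    (∫ x in Ioo 0 ℓ, v x * φ x) + (∫ x in Ioo 0 ℓ, rho p (u' x) * φ' x)
    = (∫ x in Ioo 0 ℓ, f x * φ x) + a * φ 0 + b * φ ℓ

/-- `v` is a weak solution of the interval Neumann problem (P^{γ,f}_{p,a,b}). -/
def IsNeumannWeakSolution (ℓ p : ℝ) (γ f : ℝ → ℝ) (a b : ℝ) (v : ℝ → ℝ) : Prop :=
  ∃ u u', SolvesNeumann ℓ p γ f a b v u u'

end


open Topology

/-- A bounded sequence of functions on the line with a common Lipschitz constant has a pointwise
convergent subsequence. -/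
theorem exists_subseq_tendsto_of_lipschitz {u : ℕ → ℝ → ℝ} {S M : ℝ}
    (hS : ∀ n x y, |u n x - u n y| ≤ S * |x - y|) (hM : ∀ n x, |u n x| ≤ M) :
    ∃ (v : ℝ → ℝ) (ψ : ℕ → ℕ), StrictMono ψ ∧ ∀ x, Tendsto (fun n => u (ψ n) x) atTop (𝓝 (v x)) := by
  have hcpt : IsCompact (Set.pi univ fun _ : ℚ => Icc (-M) M) :=
    isCompact_univ_pi fun _ => isCompact_Icc
  obtain ⟨w, -, ψ, hψ, hw⟩ := hcpt.tendsto_subseq (x := fun n (r : ℚ) => u n r)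
    fun n r _ => abs_le.1 (hM n r)
  have hq : ∀ r : ℚ, CauchySeq fun n => u (ψ n) r := fun r =>
    ((tendsto_pi_nhds.1 hw) r).cauchySeq
  have hS0 : 0 ≤ S := by
    have h := (abs_nonneg _).trans (hS 0 1 0)
    simpa using h
  have hcauchy : ∀ x : ℝ, CauchySeq fun n => u (ψ n) x := by
    intro x
    rw [Metric.cauchySeq_iff]
    intro ε hε
    obtain ⟨r, hxr, hrx⟩ := exists_rat_btwn (show x < x + ε / (3 * (S + 1)) by
      have : 0 < ε / (3 * (S + 1)) := by positivity
      linarith)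
    have hd : S * |x - r| ≤ ε / 3 := by
      have h1 : |x - r| ≤ ε / (3 * (S + 1)) := by
        rw [abs_sub_comm, abs_of_pos (by linarith)]
        linarith
      calc S * |x - r| ≤ (S + 1) * (ε / (3 * (S + 1))) := by gcongr; linarith
        _ = ε / 3 := by field_simp
    obtain ⟨N, hN⟩ := (Metric.cauchySeq_iff.1 (hq r)) (ε / 3) (by positivity)
    refine ⟨N, fun m hm n hn => ?_⟩
    have h1 := hN m hm n hn
    have h2 := (hS (ψ m) x r).trans hd
    have h3 := (hS (ψ n) x r).trans hd
    rw [Real.dist_eq, abs_lt] at *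
    rw [abs_le] at h2 h3
    constructor <;> linarith [h1.1, h1.2, h2.1, h2.2, h3.1, h3.2]
  choose v hv using fun x => cauchySeq_tendsto_of_complete (hcauchy x)
  exact ⟨v, ψ, hψ, hv⟩

/-- Tonelli iterates for the delayed system `u' = s x w`, `w' = γ (u (x - h))` on `[0, ℓ]`
with `u = c` and `w = α` at the origin. -/
noncomputable def tonelli (ℓ h α : ℝ) (γ : ℝ → ℝ) (s : ℝ → ℝ → ℝ) : ℕ → ℝ → ℝ → ℝ
  | 0, c, _ => c
  | k + 1, c, x => c + ∫ t in (0 : ℝ)..max 0 (min x ℓ),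
      s t (α + ∫ r in (0 : ℝ)..t, γ (tonelli ℓ h α γ s k c (r - h)))

theorem continuous_tonelli {ℓ h α : ℝ} {γ : ℝ → ℝ} {s : ℝ → ℝ → ℝ} (hγ : Continuous γ)
    (hs : Continuous fun q : ℝ × ℝ => s q.1 q.2) (k : ℕ) :
    Continuous fun q : ℝ × ℝ => tonelli ℓ h α γ s k q.1 q.2 := by
  induction k with
  | zero => exact continuous_fst
  | succ k ih =>
    simp only [tonelli]
    refine continuous_fst.add ?_
    refine intervalIntegral.continuous_parametric_intervalIntegral_of_continuous
      (f := fun (q : ℝ × ℝ) t =>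
        s t (α + ∫ r in (0 : ℝ)..t, γ (tonelli ℓ h α γ s k q.1 (r - h)))) ?_ (by fun_prop)
    have hin : Continuous fun q : (ℝ × ℝ) × ℝ =>
        ∫ r in (0 : ℝ)..q.2, γ (tonelli ℓ h α γ s k q.1.1 (r - h)) := by
      refine intervalIntegral.continuous_parametric_intervalIntegral_of_continuous
        (f := fun (q : (ℝ × ℝ) × ℝ) r => γ (tonelli ℓ h α γ s k q.1.1 (r - h))) ?_ continuous_snd
      exact hγ.comp (ih.comp ((continuous_fst.fst.fst).prodMk (continuous_snd.sub continuous_const)))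
    exact hs.comp (continuous_snd.prodMk (continuous_const.add hin))

theorem abs_tonelli_sub_le {ℓ h α S : ℝ} {γ : ℝ → ℝ} {s : ℝ → ℝ → ℝ} (hγ : Continuous γ)
    (hs : Continuous fun q : ℝ × ℝ => s q.1 q.2) (hS : ∀ t w, |s t w| ≤ S) (k : ℕ) (c x y : ℝ) :
    |tonelli ℓ h α γ s k c x - tonelli ℓ h α γ s k c y| ≤ S * |x - y| := by
  have hS0 : 0 ≤ S := (abs_nonneg _).trans (hS 0 0)
  cases k with
  | zero => simp only [tonelli, sub_self, abs_zero]; positivity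
  | succ k =>
    simp only [tonelli, add_sub_add_left_eq_sub]
    have hc : Continuous fun t =>
        s t (α + ∫ r in (0 : ℝ)..t, γ (tonelli ℓ h α γ s k c (r - h))) := by
      refine hs.comp (continuous_id.prodMk (continuous_const.add ?_))
      refine intervalIntegral.continuous_primitive (fun _ _ => Continuous.intervalIntegrable ?_ _ _) 0
      exact hγ.comp ((continuous_tonelli hγ hs k).comp
        (continuous_const.prodMk (continuous_id.sub continuous_const)))
    rw [intervalIntegral.integral_interval_sub_left (hc.intervalIntegrable _ _)
      (hc.intervalIntegrable _ _)]
    refine (intervalIntegral.norm_integral_le_of_norm_le_const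
      fun t _ => (Real.norm_eq_abs _).trans_le (hS _ _)).trans ?_
    refine mul_le_mul_of_nonneg_left ?_ hS0
    exact (abs_max_sub_max_le_max 0 _ 0 _).trans (max_le (by simp)
      ((abs_min_sub_min_le_max x ℓ y ℓ).trans (by simp)))

theorem tonelli_of_nonpos {ℓ h α : ℝ} {γ : ℝ → ℝ} {s : ℝ → ℝ → ℝ} (k : ℕ) (c : ℝ) {x : ℝ}
    (hx : x ≤ 0) : tonelli ℓ h α γ s k c x = c := by
  cases k with
  | zero => rfl
  | succ k => simp [tonelli, max_eq_left ((min_le_left x ℓ).trans hx)]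

theorem abs_tonelli_sub_le_mul_length {ℓ h α S : ℝ} {γ : ℝ → ℝ} {s : ℝ → ℝ → ℝ} (hℓ : 0 < ℓ)
    (hS : ∀ t w, |s t w| ≤ S) (k : ℕ) (c x : ℝ) :
    |tonelli ℓ h α γ s k c x - c| ≤ S * ℓ := by
  have hS0 : 0 ≤ S := (abs_nonneg _).trans (hS 0 0)
  cases k with
  | zero => simp only [tonelli, sub_self, abs_zero]; positivity
  | succ k =>
    simp only [tonelli, add_sub_cancel_left]
    refine (intervalIntegral.norm_integral_le_of_norm_le_const
      fun t _ => (Real.norm_eq_abs _).trans_le (hS _ _)).trans ?_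
    gcongr
    rw [sub_zero, abs_of_nonneg (le_max_left _ _)]
    exact max_le hℓ.le (min_le_right _ _)

theorem tonelli_succ_eq {ℓ h α : ℝ} {γ : ℝ → ℝ} {s : ℝ → ℝ → ℝ} (hh : 0 ≤ h) (k : ℕ) (c : ℝ) :
    ∀ x ≤ k * h, tonelli ℓ h α γ s (k + 1) c x = tonelli ℓ h α γ s k c x := by
  induction k with
  | zero =>
    intro x hx
    rw [tonelli_of_nonpos _ _ (by simpa using hx), tonelli_of_nonpos _ _ (by simpa using hx)]
  | succ k ih =>
    intro x hx
    rw [tonelli, tonelli]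
    congr 1
    refine intervalIntegral.integral_congr fun t ht => ?_
    rw [uIcc_of_le (le_max_left _ _)] at ht
    have htk : t ≤ (k + 1) * h := by
      refine ht.2.trans (max_le (by positivity) ((min_le_left _ _).trans ?_))
      exact_mod_cast hx
    congr 2
    refine intervalIntegral.integral_congr fun r hr => ?_
    rw [uIcc_of_le ht.1] at hr
    rw [ih]
    linarith [hr.2]

/-- A solution of the delayed system on `[0, ℓ]` with a prescribed value of `∫ γ (u (x - h))`. -/
theorem exists_delayed_solution {ℓ h α A S c₁ c₂ : ℝ} {γ : ℝ → ℝ} {s : ℝ → ℝ → ℝ} (hℓ : 0 < ℓ)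
    (hh : 0 < h) (hγ : Continuous γ) (hm : Monotone γ)
    (hs : Continuous fun q : ℝ × ℝ => s q.1 q.2) (hS : ∀ t w, |s t w| ≤ S)
    (hc₁ : γ (c₁ + S * ℓ) ≤ A / ℓ) (hc₂ : A / ℓ ≤ γ (c₂ - S * ℓ)) (hc : c₁ ≤ c₂) :
    ∃ u : ℝ → ℝ, (∀ x y, |u x - u y| ≤ S * |x - y|) ∧
      (∀ x, c₁ - S * ℓ ≤ u x ∧ u x ≤ c₂ + S * ℓ) ∧
      (∀ x ∈ Icc 0 ℓ, u x = u 0 + ∫ t in (0 : ℝ)..x, s t (α + ∫ r in (0 : ℝ)..t, γ (u (r - h)))) ∧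
      ∫ r in (0 : ℝ)..ℓ, γ (u (r - h)) = A := by
  obtain ⟨k, hk⟩ := exists_nat_ge (ℓ / h)
  rw [div_le_iff₀ hh] at hk
  have hcont := continuous_tonelli (ℓ := ℓ) (h := h) (α := α) hγ hs k
  have hint : ∀ c, IntervalIntegrable (fun r => γ (tonelli ℓ h α γ s k c (r - h))) volume 0 ℓ :=
    fun c => Continuous.intervalIntegrable (hγ.comp (hcont.comp
        (continuous_const.prodMk (continuous_id.sub continuous_const)))) _ _
  have hI : Continuous fun c => ∫ r in (0 : ℝ)..ℓ, γ (tonelli ℓ h α γ s k c (r - h)) :=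
    intervalIntegral.continuous_parametric_intervalIntegral_of_continuous'
      (f := fun c r => γ (tonelli ℓ h α γ s k c (r - h)))
      (hγ.comp (hcont.comp (continuous_fst.prodMk (continuous_snd.sub continuous_const)))) 0 ℓ
  have hb := abs_tonelli_sub_le_mul_length (h := h) (α := α) (γ := γ) hℓ hS k
  have hconst : ∫ _r in (0 : ℝ)..ℓ, A / ℓ = A := by
    simp only [intervalIntegral.integral_const, sub_zero, smul_eq_mul]
    field_simp
  obtain ⟨c, hcm, hcA⟩ := intermediate_value_Icc hc hI.continuousOn (show A ∈ Icc _ _ by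
    constructor
    · conv_rhs => rw [← hconst]
      refine intervalIntegral.integral_mono_on hℓ.le (hint _) intervalIntegrable_const fun r _ => ?_
      exact (hm (by linarith [(abs_le.1 (hb c₁ (r - h))).2])).trans hc₁
    · conv_lhs => rw [← hconst]
      refine intervalIntegral.integral_mono_on hℓ.le intervalIntegrable_const (hint _) fun r _ => ?_
      exact hc₂.trans (hm (by linarith [(abs_le.1 (hb c₂ (r - h))).1])))
  refine ⟨tonelli ℓ h α γ s k c, abs_tonelli_sub_le hγ hs hS k c, fun x => ?_, fun x hx => ?_, hcA⟩
  · have := abs_le.1 (hb c x)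
    constructor <;> linarith [hcm.1, hcm.2, this.1, this.2]
  · rw [← tonelli_succ_eq hh.le k c x (hx.2.trans hk), tonelli_of_nonpos k c le_rfl, tonelli,
      min_eq_left hx.2, max_eq_right hx.1]

/-- Solvability of the shooting problem `u' = s x w`, `w' = γ u`, `w 0 = α`, `w ℓ = α + A`
when the right-hand side `s` is bounded. -/
theorem exists_shooting_solution {ℓ α A S : ℝ} {γ : ℝ → ℝ} {s : ℝ → ℝ → ℝ} (hℓ : 0 < ℓ)
    (hγ : Continuous γ) (hm : Monotone γ) (hsurj : Function.Surjective γ)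
    (hs : Continuous fun q : ℝ × ℝ => s q.1 q.2) (hS : ∀ t w, |s t w| ≤ S) :
    ∃ u : ℝ → ℝ, Continuous u ∧
      (∀ x ∈ Icc 0 ℓ, u x = u 0 + ∫ t in (0 : ℝ)..x, s t (α + ∫ r in (0 : ℝ)..t, γ (u r))) ∧
      ∫ r in (0 : ℝ)..ℓ, γ (u r) = A := by
  have hS0 : 0 ≤ S := (abs_nonneg _).trans (hS 0 0)
  obtain ⟨d, hd⟩ := hsurj (A / ℓ)
  have hSℓ : 0 ≤ S * ℓ := by positivity
  choose u hLip hbd hsol hA using fun n : ℕ =>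
    exists_delayed_solution (α := α) (A := A) (c₁ := d - S * ℓ) (c₂ := d + S * ℓ) hℓ
      (h := 1 / ((n : ℝ) + 1)) (by positivity) hγ hm hs hS (by simp [hd]) (by simp [hd])
      (by linarith)
  set M := |d| + 2 * (S * ℓ)
  have hM : ∀ n x, |u n x| ≤ M := fun n x => by
    rw [abs_le]
    constructor <;> linarith [neg_abs_le d, le_abs_self d, (hbd n x).1, (hbd n x).2]
  obtain ⟨v, ψ, hψ, hv⟩ := exists_subseq_tendsto_of_lipschitz hLip hM
  have hvLip : ∀ x y, |v x - v y| ≤ S * |x - y| := fun x y =>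
    le_of_tendsto ((hv x).sub (hv y)).abs (Eventually.of_forall fun n => hLip _ x y)
  have hvc : Continuous v := (LipschitzWith.of_dist_le_mul (K := ⟨S, hS0⟩) hvLip).continuous
  have huc : ∀ n, Continuous (u n) := fun n =>
    (LipschitzWith.of_dist_le_mul (K := ⟨S, hS0⟩) (hLip n)).continuous
  have hdelay : ∀ x, Tendsto (fun n => u (ψ n) (x - 1 / ((ψ n : ℝ) + 1))) atTop (𝓝 (v x)) := by
    intro x
    have h0 : Tendsto (fun n => S * (1 / ((ψ n : ℝ) + 1))) atTop (𝓝 0) := by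
      simpa using (tendsto_one_div_add_atTop_nhds_zero_nat.comp hψ.tendsto_atTop).const_mul S
    have h1 : Tendsto (fun n => u (ψ n) (x - 1 / ((ψ n : ℝ) + 1)) - u (ψ n) x) atTop (𝓝 0) := by
      refine squeeze_zero_norm (fun n => ?_) h0
      refine (hLip _ _ _).trans_eq ?_
      rw [sub_sub_cancel_left, abs_neg, abs_of_pos (by positivity)]
    simpa using h1.add (hv x)
  have hγint : ∀ t, Tendsto
      (fun n => ∫ r in (0 : ℝ)..t, γ (u (ψ n) (r - 1 / ((ψ n : ℝ) + 1)))) atTop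
      (𝓝 (∫ r in (0 : ℝ)..t, γ (v r))) := by
    intro t
    refine intervalIntegral.tendsto_integral_filter_of_dominated_convergence
      (fun _ => max |γ (-M)| |γ M|) (Eventually.of_forall fun n => ?_)
      (Eventually.of_forall fun n => ae_of_all _ fun r _ => ?_) intervalIntegrable_const
      (ae_of_all _ fun r _ => (hγ.tendsto _).comp (hdelay r))
    · exact (hγ.comp ((huc _).comp (continuous_id.sub continuous_const))).aestronglyMeasurable
    · have := abs_le.1 (hM (ψ n) (r - 1 / ((ψ n : ℝ) + 1)))
      exact abs_le_max_abs_abs (hm this.1) (hm this.2)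
  refine ⟨v, hvc, fun x hx => ?_, ?_⟩
  · refine tendsto_nhds_unique (hv x) ?_
    simp only [fun n => hsol (ψ n) x hx]
    refine (hv 0).add ?_
    refine intervalIntegral.tendsto_integral_filter_of_dominated_convergence
      (fun _ => S) (Eventually.of_forall fun n => ?_)
      (Eventually.of_forall fun n => ae_of_all _ fun r _ => hS _ _) intervalIntegrable_const
      (ae_of_all _ fun r _ => ?_)
    · refine (hs.comp (continuous_id.prodMk (continuous_const.add ?_))).aestronglyMeasurable
      refine intervalIntegral.continuous_primitive (fun _ _ => Continuous.intervalIntegrable ?_ _ _) 0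
      exact hγ.comp ((huc _).comp (continuous_id.sub continuous_const))
    · exact (hs.tendsto (r, α + ∫ r in (0 : ℝ)..r, γ (v r))).comp
        (tendsto_const_nhds.prodMk_nhds ((hγint r).const_add α))
  · refine tendsto_nhds_unique (hγint ℓ) ?_
    simp only [fun n => hA (ψ n)]
    exact tendsto_const_nhds

/-- The odd extension of `x ↦ x ^ r` to the real line. -/
noncomputable def signedPow (r x : ℝ) : ℝ := max x 0 ^ r - max (-x) 0 ^ r

theorem signedPow_of_nonneg {r x : ℝ} (hr : 0 < r) (hx : 0 ≤ x) : signedPow r x = x ^ r := by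
  rw [signedPow, max_eq_left hx, max_eq_right (by linarith), Real.zero_rpow hr.ne', sub_zero]

theorem signedPow_of_nonpos {r x : ℝ} (hr : 0 < r) (hx : x ≤ 0) :
    signedPow r x = -(-x) ^ r := by
  rw [signedPow, max_eq_right hx, max_eq_left (by linarith), Real.zero_rpow hr.ne', zero_sub]

theorem continuous_signedPow {r : ℝ} (hr : 0 < r) : Continuous (signedPow r) :=
  ((continuous_id.max continuous_const).rpow_const fun _ => Or.inr hr.le).sub
    ((continuous_neg.max continuous_const).rpow_const fun _ => Or.inr hr.le)

theorem monotone_signedPow {r : ℝ} (hr : 0 < r) : Monotone (signedPow r) := by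
  intro x y hxy
  unfold signedPow
  gcongr

theorem signedPow_zero {r : ℝ} (hr : 0 < r) : signedPow r 0 = 0 := by
  rw [signedPow_of_nonneg hr le_rfl, Real.zero_rpow hr.ne']

theorem abs_signedPow {r : ℝ} (hr : 0 < r) (x : ℝ) : |signedPow r x| = |x| ^ r := by
  rcases le_total 0 x with hx | hx
  · rw [signedPow_of_nonneg hr hx, abs_of_nonneg hx, abs_of_nonneg (by positivity)]
  · rw [signedPow_of_nonpos hr hx, abs_neg, abs_of_nonpos hx,
      abs_of_nonneg (Real.rpow_nonneg (by linarith) _)]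

theorem signedPow_signedPow_inv {r : ℝ} (hr : 0 < r) (x : ℝ) :
    signedPow r (signedPow r⁻¹ x) = x := by
  have hr' := inv_pos.2 hr
  rcases le_total 0 x with hx | hx
  · rw [signedPow_of_nonneg hr' hx, signedPow_of_nonneg hr (by positivity),
      Real.rpow_inv_rpow hx hr.ne']
  · have hx' : 0 ≤ -x := by linarith
    rw [signedPow_of_nonpos hr' hx,
      signedPow_of_nonpos hr (neg_nonpos.2 (Real.rpow_nonneg hx' _)), neg_neg,
      Real.rpow_inv_rpow hx' hr.ne', neg_neg]

theorem rho_eq_signedPow {p : ℝ} (hp : 1 < p) (x : ℝ) : rho p x = signedPow (p - 1) x := by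
  have hp' : 0 < p - 1 := by linarith
  have hadd : ∀ y : ℝ, 0 ≤ y → y ^ (p - 1) = y ^ (p - 2) * y := fun y hy => by
    rw [← Real.rpow_add_one' hy (by linarith)]
    ring_nf
  rcases le_total 0 x with hx | hx
  · rw [signedPow_of_nonneg hp' hx, rho, abs_of_nonneg hx, hadd x hx]
  · rw [signedPow_of_nonpos hp' hx, rho, abs_of_nonpos hx, hadd (-x) (by linarith)]
    ring

theorem abs_rho_mul_le {p : ℝ} (hp : 1 < p) (x y : ℝ) :
    |rho p x * y| ≤ |x| ^ p + |y| ^ p := by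
  have hp' : 0 < p - 1 := by linarith
  have hadd : ∀ y : ℝ, |y| ^ (p - 1) * |y| = |y| ^ p := fun y => by
    rw [← Real.rpow_add_one' (abs_nonneg y) (by linarith)]
    ring_nf
  rw [abs_mul, rho_eq_signedPow hp, abs_signedPow hp']
  have hx : 0 ≤ |x| ^ p := by positivity
  have hy : 0 ≤ |y| ^ p := by positivity
  rcases le_total |x| |y| with h | h
  · calc |x| ^ (p - 1) * |y| ≤ |y| ^ (p - 1) * |y| := by gcongr
      _ ≤ |x| ^ p + |y| ^ p := by rw [hadd]; linarith
  · calc |x| ^ (p - 1) * |y| ≤ |x| ^ (p - 1) * |x| := by gcongr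
      _ ≤ |x| ^ p + |y| ^ p := by rw [hadd]; linarith

theorem abs_sub_rpow_le {p : ℝ} (hp : 0 ≤ p) (x y : ℝ) :
    |x - y| ^ p ≤ 2 ^ p * (|x| ^ p + |y| ^ p) := by
  have hx : 0 ≤ |x| ^ p := by positivity
  have hy : 0 ≤ |y| ^ p := by positivity
  have hxy := abs_sub x y
  rcases le_total |x| |y| with h | h
  · calc |x - y| ^ p ≤ (2 * |y|) ^ p := by gcongr; linarith
      _ = 2 ^ p * |y| ^ p := Real.mul_rpow (by norm_num) (abs_nonneg _)
      _ ≤ _ := by gcongr; linarith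
  · calc |x - y| ^ p ≤ (2 * |x|) ^ p := by gcongr; linarith
      _ = 2 ^ p * |x| ^ p := Real.mul_rpow (by norm_num) (abs_nonneg _)
      _ ≤ _ := by gcongr; linarith

theorem integrableOn_Ioo_iff_intervalIntegrable {ℓ : ℝ} (hℓ : 0 ≤ ℓ) {g : ℝ → ℝ} :
    IntegrableOn g (Ioo 0 ℓ) volume ↔ IntervalIntegrable g volume 0 ℓ := by
  rw [intervalIntegrable_iff_integrableOn_Ioc_of_le hℓ, integrableOn_Ioc_iff_integrableOn_Ioo]

theorem setIntegral_Ioo_eq_intervalIntegral {ℓ : ℝ} (hℓ : 0 ≤ ℓ) (g : ℝ → ℝ) :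
    ∫ x in Ioo 0 ℓ, g x = ∫ x in (0 : ℝ)..ℓ, g x := by
  rw [intervalIntegral.integral_of_le hℓ, integral_Ioc_eq_integral_Ioo]

theorem intervalIntegral_nonpos {x y : ℝ} {g : ℝ → ℝ} (hxy : x ≤ y)
    (hg : ∀ t ∈ Icc x y, g t ≤ 0) : ∫ t in x..y, g t ≤ 0 := by
  have h := intervalIntegral.integral_nonneg (f := fun t => -g t) (μ := volume) hxy
    fun t ht => neg_nonneg.2 (hg t ht)
  rw [intervalIntegral.integral_neg] at h
  linarith

theorem absolutelyContinuousOnInterval_const_add_primitive {ℓ : ℝ} {g : ℝ → ℝ} (c : ℝ)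
    (hg : IntervalIntegrable g volume 0 ℓ) :
    AbsolutelyContinuousOnInterval (fun x => c + ∫ t in (0 : ℝ)..x, g t) 0 ℓ := by
  have hc : AbsolutelyContinuousOnInterval (fun _ : ℝ => c) 0 ℓ :=
    (LipschitzWith.const c).lipschitzOnWith.absolutelyContinuousOnInterval
  exact hc.add (hg.absolutelyContinuousOnInterval_intervalIntegral left_mem_uIcc)

/-- Integration by parts for primitives of integrable functions. -/
theorem integral_primitive_mul_eq {ℓ : ℝ} (hℓ : 0 ≤ ℓ) {w g φ φ' : ℝ → ℝ}
    (hg : IntervalIntegrable g volume 0 ℓ) (hφ' : IntervalIntegrable φ' volume 0 ℓ)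
    (hw : ∀ x ∈ Icc 0 ℓ, w x = w 0 + ∫ t in (0 : ℝ)..x, g t)
    (hφ : ∀ x ∈ Icc 0 ℓ, φ x = φ 0 + ∫ t in (0 : ℝ)..x, φ' t) :
    ∫ x in (0 : ℝ)..ℓ, w x * φ' x = w ℓ * φ ℓ - w 0 * φ 0 - ∫ x in (0 : ℝ)..ℓ, g x * φ x := by
  have key := (absolutelyContinuousOnInterval_const_add_primitive (w 0)
    hg).integral_mul_deriv_eq_deriv_mul
      (absolutelyContinuousOnInterval_const_add_primitive (φ 0) hφ')
  have hdg : ∀ᵐ x, x ∈ uIcc 0 ℓ → deriv (fun x => w 0 + ∫ t in (0 : ℝ)..x, g t) x = g x := by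
    filter_upwards [hg.ae_hasDerivAt_integral] with x hx hxm
    exact ((hx hxm 0 left_mem_uIcc).const_add _).deriv
  have hdφ : ∀ᵐ x, x ∈ uIcc 0 ℓ → deriv (fun x => φ 0 + ∫ t in (0 : ℝ)..x, φ' t) x = φ' x := by
    filter_upwards [hφ'.ae_hasDerivAt_integral] with x hx hxm
    exact ((hx hxm 0 left_mem_uIcc).const_add _).deriv
  have h1 : ∫ x in (0 : ℝ)..ℓ, w x * φ' x = ∫ x in (0 : ℝ)..ℓ, (w 0 + ∫ t in (0 : ℝ)..x, g t) *
      deriv (fun x => φ 0 + ∫ t in (0 : ℝ)..x, φ' t) x := by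
    refine intervalIntegral.integral_congr_ae ?_
    filter_upwards [hdφ] with x hx hxm
    have hxm' := uIoc_subset_uIcc hxm
    rw [hx hxm', ← hw x (uIcc_of_le hℓ ▸ hxm')]
  have h2 : ∫ x in (0 : ℝ)..ℓ, g x * φ x =
      ∫ x in (0 : ℝ)..ℓ, deriv (fun x => w 0 + ∫ t in (0 : ℝ)..x, g t) x *
        (φ 0 + ∫ t in (0 : ℝ)..x, φ' t) := by
    refine intervalIntegral.integral_congr_ae ?_
    filter_upwards [hdg] with x hx hxm
    have hxm' := uIoc_subset_uIcc hxm
    rw [hx hxm', ← hφ x (uIcc_of_le hℓ ▸ hxm')]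
  rw [h1, key, h2, ← hw ℓ (right_mem_Icc.2 hℓ), ← hφ ℓ (right_mem_Icc.2 hℓ)]
  simp

namespace IntervalSobolev

theorem continuousOn {ℓ p : ℝ} (hℓ : 0 ≤ ℓ) {u u' : ℝ → ℝ} (h : IntervalSobolev ℓ p u u') :
    ContinuousOn u (Icc 0 ℓ) := by
  have hac := (absolutelyContinuousOnInterval_const_add_primitive (u 0)
    ((integrableOn_Ioo_iff_intervalIntegrable hℓ).1 h.1)).continuousOn
  rw [uIcc_of_le hℓ] at hac
  exact hac.congr h.2.2

theorem integrableOn_mul {ℓ p : ℝ} (hℓ : 0 ≤ ℓ) {u u' v : ℝ → ℝ} (h : IntervalSobolev ℓ p u u')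
    (hv : IntegrableOn v (Ioo 0 ℓ) volume) :
    IntegrableOn (fun x => v x * u x) (Ioo 0 ℓ) volume := by
  rw [← integrableOn_Icc_iff_integrableOn_Ioo] at hv ⊢
  exact hv.mul_continuousOn (h.continuousOn hℓ) isCompact_Icc

theorem sub {ℓ p : ℝ} (hℓ : 0 ≤ ℓ) (hp : 0 ≤ p) {u u' φ φ' : ℝ → ℝ}
    (hu : IntervalSobolev ℓ p u u') (hφ : IntervalSobolev ℓ p φ φ') :
    IntervalSobolev ℓ p (fun x => u x - φ x) (fun x => u' x - φ' x) := by
  refine ⟨hu.1.sub hφ.1, ?_, fun x hx => ?_⟩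
  · refine Integrable.mono' ((hu.2.1.add hφ.2.1).const_mul (2 ^ p)) ?_ (ae_of_all _ fun x => ?_)
    · have hm : AEMeasurable (fun x => u' x - φ' x) (volume.restrict (Ioo 0 ℓ)) :=
        hu.1.aemeasurable.sub hφ.1.aemeasurable
      exact (hm.abs.pow_const p).aestronglyMeasurable
    · rw [Real.norm_of_nonneg (by positivity)]
      exact abs_sub_rpow_le hp _ _
  · have hsub : uIcc 0 x ⊆ uIcc 0 ℓ := by
      rw [uIcc_of_le hx.1, uIcc_of_le hℓ]
      exact Icc_subset_Icc_right hx.2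
    rw [intervalIntegral.integral_sub
      (((integrableOn_Ioo_iff_intervalIntegrable hℓ).1 hu.1).mono_set hsub)
      (((integrableOn_Ioo_iff_intervalIntegrable hℓ).1 hφ.1).mono_set hsub),
      ← sub_eq_iff_eq_add'.2 (hu.2.2 x hx), ← sub_eq_iff_eq_add'.2 (hφ.2.2 x hx)]
    ring

theorem integrableOn_rho_mul {ℓ p : ℝ} (hp : 1 < p) {u u' φ φ' : ℝ → ℝ}
    (hu : IntervalSobolev ℓ p u u') (hφ : IntervalSobolev ℓ p φ φ') :
    IntegrableOn (fun x => rho p (u' x) * φ' x) (Ioo 0 ℓ) volume := by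
  refine Integrable.mono' (hu.2.1.add hφ.2.1) ?_ (ae_of_all _ fun x => abs_rho_mul_le hp _ _)
  simp only [rho_eq_signedPow hp]
  exact ((continuous_signedPow (by linarith)).comp_aestronglyMeasurable
    hu.1.aestronglyMeasurable).mul hφ.1.aestronglyMeasurable

end IntervalSobolev

theorem IsNeumannWeakSolution.ae_eq {ℓ p : ℝ} (hℓ : 0 ≤ ℓ) (hp : 1 < p) {γ f : ℝ → ℝ}
    (hγ : StrictMono γ) {a b : ℝ} {v₁ v₂ : ℝ → ℝ} (h₁ : IsNeumannWeakSolution ℓ p γ f a b v₁)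
    (h₂ : IsNeumannWeakSolution ℓ p γ f a b v₂) :
    v₁ =ᵐ[volume.restrict (Ioo 0 ℓ)] v₂ := by
  obtain ⟨u₁, u₁', hv₁, hu₁, hγ₁, hw₁⟩ := h₁
  obtain ⟨u₂, u₂', hv₂, hu₂, hγ₂, hw₂⟩ := h₂
  have hφ := hu₁.sub hℓ (by linarith) hu₂
  have e := (hw₁ _ _ hφ).trans (hw₂ _ _ hφ).symm
  have i₁ := hφ.integrableOn_mul hℓ hv₁
  have i₂ := hφ.integrableOn_mul hℓ hv₂
  have j₁ := hu₁.integrableOn_rho_mul hp hφ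
  have j₂ := hu₂.integrableOn_rho_mul hp hφ
  have hI := integral_sub i₁ i₂
  have hJ := integral_sub j₁ j₂
  have hJ0 : 0 ≤ ∫ x in Ioo 0 ℓ, (rho p (u₁' x) * (u₁' x - u₂' x)
      - rho p (u₂' x) * (u₁' x - u₂' x)) := by
    refine integral_nonneg fun x => ?_
    simp only [rho_eq_signedPow hp, ← sub_mul, Pi.zero_apply]
    have hm := monotone_signedPow (r := p - 1) (by linarith)
    rcases le_total (u₁' x) (u₂' x) with h | h
    · exact mul_nonneg_of_nonpos_of_nonpos (sub_nonpos.2 (hm h)) (sub_nonpos.2 h)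
    · exact mul_nonneg (sub_nonneg.2 (hm h)) (sub_nonneg.2 h)
  have hnn : 0 ≤ᵐ[volume.restrict (Ioo 0 ℓ)]
      fun x => v₁ x * (u₁ x - u₂ x) - v₂ x * (u₁ x - u₂ x) := by
    filter_upwards [hγ₁, hγ₂] with x h1 h2
    simp only [← sub_mul, Pi.zero_apply, h1, h2]
    rcases le_total (u₁ x) (u₂ x) with h | h
    · exact mul_nonneg_of_nonpos_of_nonpos (sub_nonpos.2 (hγ.monotone h)) (sub_nonpos.2 h)
    · exact mul_nonneg (sub_nonneg.2 (hγ.monotone h)) (sub_nonneg.2 h)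
  have hI0 := integral_nonneg_of_ae hnn
  have hzero := (integral_eq_zero_iff_of_nonneg_ae hnn (i₁.sub i₂)).1 (by linarith)
  filter_upwards [hγ₁, hγ₂, hzero] with x h1 h2 h3
  rw [Pi.zero_apply, ← sub_mul, mul_eq_zero] at h3
  rcases h3 with h3 | h3
  · exact sub_eq_zero.1 h3
  · rw [h1, h2, sub_eq_zero.1 h3]

/-- While `u` and `w` are nonnegative, `u` increases and `w` loses at most `K`; hence `w` cannot
exceed its terminal bound by more than `K` at a point where `u` is nonnegative. -/
theorem le_add_of_cooperative {ℓ B K : ℝ} {u w : ℝ → ℝ} (hw : ContinuousOn w (Icc 0 ℓ))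
    (hu_mono : ∀ x y, 0 ≤ x → x ≤ y → y ≤ ℓ → (∀ t ∈ Icc x y, 0 ≤ w t) → u x ≤ u y)
    (hw_loss : ∀ x y, 0 ≤ x → x ≤ y → y ≤ ℓ → (∀ t ∈ Icc x y, 0 ≤ u t) → w x ≤ w y + K)
    (hB : 0 ≤ B) (hK : 0 ≤ K) (hwℓ : w ℓ ≤ B) {x : ℝ} (hx : x ∈ Icc 0 ℓ) (hux : 0 ≤ u x) :
    w x ≤ B + K := by
  by_contra! hlt
  have hwx : ContinuousOn w (Icc x ℓ) := hw.mono (Icc_subset_Icc_left hx.1)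
  have hcpt : IsCompact (Icc x ℓ ∩ w ⁻¹' {B}) :=
    isCompact_Icc.of_isClosed_subset
      (hwx.preimage_isClosed_of_isClosed isClosed_Icc isClosed_singleton) inter_subset_left
  obtain ⟨z, hz, hzB⟩ := intermediate_value_Icc' hx.2 hwx (show B ∈ Icc _ _ from
    ⟨hwℓ, by linarith⟩)
  obtain ⟨y, ⟨hy, hyB⟩, hleast⟩ := hcpt.exists_isLeast ⟨z, hz, hzB⟩
  have hpos : ∀ t ∈ Icc x y, 0 ≤ w t := by
    intro t ht
    by_contra! hneg
    obtain ⟨r, hr, hrB⟩ := intermediate_value_Icc' ht.1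
      (hwx.mono (Icc_subset_Icc_right (ht.2.trans hy.2)))
      (show B ∈ Icc _ _ from ⟨by linarith, by linarith⟩)
    have hyr := hleast ⟨⟨hr.1, hr.2.trans (ht.2.trans hy.2)⟩, hrB⟩
    have hty : t = y := le_antisymm ht.2 (hyr.trans hr.2)
    rw [hty, hyB] at hneg
    linarith
  have hu : ∀ t ∈ Icc x y, 0 ≤ u t := fun t ht =>
    hux.trans (hu_mono x t hx.1 ht.1 (ht.2.trans hy.2) fun r hr =>
      hpos r ⟨hr.1, hr.2.trans ht.2⟩)
  have h := hw_loss x y hx.1 hy.1 hy.2 hu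
  rw [hyB] at h
  linarith

/-- A priori bound for a cooperative pair `(u, w)` with prescribed boundary values of `w`. -/
theorem abs_le_of_cooperative {ℓ K : ℝ} {u w : ℝ → ℝ} (hw : ContinuousOn w (Icc 0 ℓ))
    (hu_mono : ∀ x y, 0 ≤ x → x ≤ y → y ≤ ℓ → (∀ t ∈ Icc x y, 0 ≤ w t) → u x ≤ u y)
    (hu_anti : ∀ x y, 0 ≤ x → x ≤ y → y ≤ ℓ → (∀ t ∈ Icc x y, w t ≤ 0) → u y ≤ u x)
    (hw_loss : ∀ x y, 0 ≤ x → x ≤ y → y ≤ ℓ → (∀ t ∈ Icc x y, 0 ≤ u t) → w x ≤ w y + K)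
    (hw_gain : ∀ x y, 0 ≤ x → x ≤ y → y ≤ ℓ → (∀ t ∈ Icc x y, u t ≤ 0) → w y ≤ w x + K)
    (hK : 0 ≤ K) {x : ℝ} (hx : x ∈ Icc 0 ℓ) :
    |w x| ≤ |w 0| + |w ℓ| + K := by
  have hrefl : ContinuousOn (fun t => w (ℓ - t)) (Icc 0 ℓ) :=
    hw.comp (by fun_prop) fun t ht => ⟨by linarith [ht.2], by linarith [ht.1]⟩
  have hx' : ℓ - x ∈ Icc 0 ℓ := ⟨by linarith [hx.2], by linarith [hx.1]⟩
  have h0 := abs_nonneg (w 0)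
  have h1 := abs_nonneg (w ℓ)
  have mem : ∀ {y z t : ℝ}, t ∈ Icc (ℓ - z) (ℓ - y) → ℓ - t ∈ Icc y z := fun ht =>
    ⟨by linarith [ht.2], by linarith [ht.1]⟩
  rw [abs_le]
  rcases le_total 0 (u x) with hux | hux
  · constructor
    · have := le_add_of_cooperative (u := fun t => u (ℓ - t)) (w := fun t => -w (ℓ - t))
        (B := |w 0|) (K := K) hrefl.neg
        (fun y z hy hyz hz h => hu_anti (ℓ - z) (ℓ - y) (by linarith) (by linarith) (by linarith)
          fun t ht => by simpa using h (ℓ - t) (mem ht))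
        (fun y z hy hyz hz h => by
          have := hw_loss (ℓ - z) (ℓ - y) (by linarith) (by linarith) (by linarith)
            fun t ht => by simpa using h (ℓ - t) (mem ht)
          linarith) h0 hK (by simpa using neg_le_abs (w 0)) hx' (by simpa using hux)
      simp only [sub_sub_cancel] at this
      linarith
    · have := le_add_of_cooperative hw hu_mono hw_loss h1 hK (le_abs_self _) hx hux
      linarith
  · constructor
    · have := le_add_of_cooperative (u := fun t => -u t) (w := fun t => -w t)
        (B := |w ℓ|) (K := K) hw.neg
        (fun y z hy hyz hz h => neg_le_neg (hu_anti y z hy hyz hz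
          fun t ht => by simpa using h t ht))
        (fun y z hy hyz hz h => by
          have := hw_gain y z hy hyz hz fun t ht => by simpa using h t ht
          linarith) h1 hK (neg_le_abs _) hx (by simpa using hux)
      linarith
    · have := le_add_of_cooperative (u := fun t => -u (ℓ - t)) (w := fun t => w (ℓ - t))
        (B := |w 0|) (K := K) hrefl
        (fun y z hy hyz hz h => neg_le_neg (hu_mono (ℓ - z) (ℓ - y) (by linarith) (by linarith)
          (by linarith) fun t ht => by simpa using h (ℓ - t) (mem ht)))
        (fun y z hy hyz hz h => hw_gain (ℓ - z) (ℓ - y) (by linarith) (by linarith) (by linarith)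
            fun t ht => by simpa using h (ℓ - t) (mem ht))
        h0 hK (by simpa using le_abs_self (w 0)) hx' (by simpa using hux)
      simp only [sub_sub_cancel] at this
      linarith

theorem exists_isNeumannWeakSolution {ℓ p : ℝ} (hℓ : 0 < ℓ) (hp : 1 < p) {γ f : ℝ → ℝ}
    (hγ : Continuous γ) (hm : Monotone γ) (hsurj : Function.Surjective γ) (hγ0 : γ 0 = 0)
    (hf : IntegrableOn f (Ioo 0 ℓ) volume) (a b : ℝ) :
    ∃ v, IsNeumannWeakSolution ℓ p γ f a b v := by
  set g := (Ioo 0 ℓ).indicator f with hgdef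
  have hg : Integrable g := (integrable_indicator_iff measurableSet_Ioo).2 hf
  set F : ℝ → ℝ := fun x => ∫ t in (0 : ℝ)..x, g t with hF
  have hFc : Continuous F :=
    intervalIntegral.continuous_primitive (fun _ _ => hg.intervalIntegrable) 0
  set K := ∫ t, ‖g t‖
  have hK : 0 ≤ K := integral_nonneg fun _ => norm_nonneg _
  have hFK : ∀ x y, |F y - F x| ≤ K := by
    intro x y
    have hd : F y - F x = ∫ t in x..y, g t :=
      intervalIntegral.integral_interval_sub_left hg.intervalIntegrable hg.intervalIntegrable
    rw [hd, ← Real.norm_eq_abs]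
    refine (intervalIntegral.norm_integral_le_integral_norm_uIoc (f := g) (μ := volume)).trans ?_
    exact setIntegral_le_integral hg.norm (ae_of_all _ fun _ => norm_nonneg _)
  set C := |a| + |b| + K
  have hC0 : 0 ≤ C := by positivity
  have hr : 0 < (p - 1)⁻¹ := inv_pos.2 (by linarith)
  set σ := signedPow (p - 1)⁻¹ with hσ
  have hσc : Continuous σ := continuous_signedPow hr
  have hσm : Monotone σ := monotone_signedPow hr
  have hσ0 : σ 0 = 0 := signedPow_zero hr
  obtain ⟨u, huc, hu, hA⟩ := exists_shooting_solution (α := -a) (A := a + b + F ℓ)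
    (s := fun t z => σ (max (-C) (min (z - F t) C))) (S := C ^ (p - 1)⁻¹) hℓ hγ hm hsurj
    (hσc.comp (by fun_prop)) (fun t z => by
      rw [hσ, abs_signedPow hr]
      refine Real.rpow_le_rpow (abs_nonneg _) (abs_le.2 ⟨le_max_left _ _, ?_⟩) hr.le
      exact max_le (by linarith) (min_le_right _ _))
  set w : ℝ → ℝ := fun x => -a + (∫ r in (0 : ℝ)..x, γ (u r)) - F x with hwdef
  have hγu : Continuous fun x => γ (u x) := hγ.comp huc
  have hwc : Continuous w := (continuous_const.add (intervalIntegral.continuous_primitive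
    (fun _ _ => hγu.intervalIntegrable _ _) 0)).sub hFc
  have hw0 : w 0 = -a := by simp [hwdef, hF]
  have hwℓ : w ℓ = b := by simp only [hwdef, hA]; ring
  set s : ℝ → ℝ := fun t => σ (max (-C) (min (w t) C)) with hs
  have hsc : Continuous s := hσc.comp (by fun_prop)
  have hudiff : ∀ x y, 0 ≤ x → x ≤ y → y ≤ ℓ → u y - u x = ∫ t in x..y, s t := by
    intro x y hx hxy hy
    rw [hu x ⟨hx, hxy.trans hy⟩, hu y ⟨hx.trans hxy, hy⟩, add_sub_add_left_eq_sub,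
      ← intervalIntegral.integral_interval_sub_left (hsc.intervalIntegrable 0 y)
        (hsc.intervalIntegrable 0 x)]
  have hwdiff : ∀ x y, w y - w x = (∫ t in x..y, γ (u t)) - (F y - F x) := by
    intro x y
    rw [← intervalIntegral.integral_interval_sub_left (hγu.intervalIntegrable 0 y)
        (hγu.intervalIntegrable 0 x)]
    simp only [hwdef]
    ring
  have hwC : ∀ x ∈ Icc 0 ℓ, |w x| ≤ C := by
    intro x hx
    have := abs_le_of_cooperative (u := u) (K := K) hwc.continuousOn
      (fun x y hx hxy hy h => by
        rw [← sub_nonneg, hudiff x y hx hxy hy]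
        refine intervalIntegral.integral_nonneg hxy fun t ht => ?_
        rw [← hσ0]
        exact hσm (le_max_of_le_right (le_min (h t ht) hC0)))
      (fun x y hx hxy hy h => by
        rw [← sub_nonpos, hudiff x y hx hxy hy]
        refine intervalIntegral_nonpos hxy fun t ht => ?_
        rw [← hσ0]
        exact hσm (max_le (by linarith) (min_le_of_left_le (h t ht))))
      (fun x y hx hxy hy h => by
        have h1 : 0 ≤ ∫ t in x..y, γ (u t) :=
          intervalIntegral.integral_nonneg hxy fun t ht => hγ0 ▸ hm (h t ht)
        linarith [hwdiff x y, (abs_le.1 (hFK x y)).2])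
      (fun x y hx hxy hy h => by
        have h1 : ∫ t in x..y, γ (u t) ≤ 0 :=
          intervalIntegral_nonpos hxy fun t ht => hγ0 ▸ hm (h t ht)
        linarith [hwdiff x y, (abs_le.1 (hFK x y)).1])
      hK hx
    rwa [hw0, hwℓ, abs_neg] at this
  have hsσ : ∀ x ∈ Icc 0 ℓ, s x = σ (w x) := fun x hx => by
    have := abs_le.1 (hwC x hx)
    rw [hs]
    simp only [min_eq_left this.2, max_eq_right this.1]
  have hσw : Continuous fun x => σ (w x) := hσc.comp hwc
  have hSob : IntervalSobolev ℓ p u fun x => σ (w x) := by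
    refine ⟨hσw.continuousOn.integrableOn_Icc.mono_set Ioo_subset_Icc_self,
      ((hσw.abs.rpow_const fun _ => Or.inr (by linarith)).continuousOn.integrableOn_Icc).mono_set
        Ioo_subset_Icc_self, fun x hx => ?_⟩
    rw [hu x hx]
    congr 1
    refine intervalIntegral.integral_congr fun t ht => ?_
    rw [uIcc_of_le hx.1] at ht
    exact hsσ t ⟨ht.1, ht.2.trans hx.2⟩
  have hγi : IntegrableOn (fun x => γ (u x)) (Ioo 0 ℓ) volume :=
    hγu.continuousOn.integrableOn_Icc.mono_set Ioo_subset_Icc_self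
  refine ⟨fun x => γ (u x), u, fun x => σ (w x), hγi, hSob, ae_of_all _ fun _ => rfl,
    fun φ φ' hφ => ?_⟩
  have hrho : ∀ x, rho p (σ (w x)) = w x := fun x => by
    rw [rho_eq_signedPow hp, hσ, signedPow_signedPow_inv (by linarith)]
  have hparts := integral_primitive_mul_eq hℓ.le (w := w) (g := fun x => γ (u x) - g x)
    ((hγu.intervalIntegrable _ _).sub hg.intervalIntegrable)
    ((integrableOn_Ioo_iff_intervalIntegrable hℓ.le).1 hφ.1)
    (fun x hx => by
      rw [intervalIntegral.integral_sub (hγu.intervalIntegrable _ _) hg.intervalIntegrable, hw0]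
      simp only [hwdef, hF]
      ring) hφ.2.2
  have hgf : ∫ x in Ioo 0 ℓ, (γ (u x) - g x) * φ x = ∫ x in Ioo 0 ℓ, (γ (u x) * φ x - f x * φ x) :=
    setIntegral_congr_fun measurableSet_Ioo fun x hx => by
      simp only [hgdef, indicator_of_mem hx, sub_mul]
  rw [← setIntegral_Ioo_eq_intervalIntegral hℓ.le, ← setIntegral_Ioo_eq_intervalIntegral hℓ.le,
    hgf, integral_sub (hφ.integrableOn_mul hℓ.le hγi) (hφ.integrableOn_mul hℓ.le hf), hw0, hwℓ]
    at hparts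
  simp only [hrho]
  rw [hparts]
  ring

/-- existence and uniqueness of the weak solution of the interval
Neumann problem (P^{γ,f}_{p,a,b}). -/
theorem neumann_interval_exists_unique
    (ℓ : ℝ) (hℓ : 0 < ℓ) (p : ℝ) (hp : 1 < p)
    (γ : ℝ → ℝ) (hγc : Continuous γ) (hγm : StrictMono γ)
    (hγs : Function.Surjective γ) (hγ0 : γ 0 = 0)
    (f : ℝ → ℝ) (hf : IntegrableOn f (Ioo 0 ℓ) volume) (a b : ℝ) :
    (∃ v : ℝ → ℝ, IsNeumannWeakSolution ℓ p γ f a b v) ∧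
    (∀ v₁ v₂ : ℝ → ℝ, IsNeumannWeakSolution ℓ p γ f a b v₁ →
      IsNeumannWeakSolution ℓ p γ f a b v₂ →
      v₁ =ᵐ[volume.restrict (Ioo 0 ℓ)] v₂) := by
  exact ⟨exists_isNeumannWeakSolution hℓ hp hγc hγm.monotone hγs hγ0 hf a b,
    fun _ _ h₁ h₂ => h₁.ae_eq hℓ.le hp hγm h₂⟩
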